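/- Let A be a finite nonempty linearly ordered set with maximum m. The function h_A : P^r_A → (ℤ×ℤ₊, ≤̇), h_A(λ) = (#C, #B) for the unique presentation λ = π|B|ρ with m ∈ B, is a discrete Morse function associated to the discrete vector field V^r_A on P^r_A; consequently V^r_A is a gradient field on P^r_A. -/

import Mathlib

section Core

variable {A : Type*} [DecidableEq A] [Fintype A]

/-- A cube of the standard `A`-cube: `none` means `*`, `some true` means `1`,
`some false` means `0`. -/
abbrev Cube (A : Type*) := A → Option Bool

/-- The cube `c(O, S, rest)` with value `1` on `O`, `*` on `S` and `0` elsewhere. -/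
def cubeOn (O S : Finset A) : Cube A := fun a =>
  if a ∈ S then none else if a ∈ O then some true else some false

/-- An `A`-cubical complex: a set of cubes closed under the face maps, i.e. under
replacing any occurrence of `*` by `0` or `1`. -/
def IsComplex (K : Set (Cube A)) : Prop :=
  ∀ c ∈ K, ∀ a : A, c a = none → ∀ ε : Bool, Function.update c a (some ε) ∈ K

/-- Union of the blocks of a list of finsets. -/
def blocksUnion (L : List (Finset A)) : Finset A := L.foldr (· ∪ ·) ∅

/-- `L` is an ordered partition of `S`: a sequence of nonempty pairwise disjoint
subsets whose union is `S`. -/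
def IsOPart (S : Finset A) (L : List (Finset A)) : Prop :=
  (∀ B ∈ L, B.Nonempty) ∧
    List.Pairwise (fun B C : Finset A => Disjoint B C) L ∧ blocksUnion L = S

/-- The set `P_K` of ordered partitions `L = B₁|…|B_l` of `S` such that each cube
`c((O ∪ B₁∪…∪B_{i-1}), B_i, rest)` belongs to `K`.  Here `O` records the part of the
ambient set on which the cubes take the fixed value `1` (used for the restrictions
`K|_B^ε`); for the full complex take `O = ∅`, `S = univ`. -/
def PK (K : Set (Cube A)) (O S : Finset A) : Set (List (Finset A)) :=
  {L | IsOPart S L ∧ ∀ (i : ℕ) (h : i < L.length),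
    cubeOn (O ∪ blocksUnion (L.take i)) (L[i]'h) ∈ K}

/-- `x` refines `y`: the blocks of `y` are obtained by uniting consecutive blocks of `x`. -/
def Refines (x y : List (Finset A)) : Prop :=
  ∃ LL : List (List (Finset A)), (∀ l ∈ LL, l ≠ []) ∧
    x = LL.flatten ∧ y = LL.map blocksUnion

/-- Dimension of an ordered partition: `Σ (#Bᵢ - 1)`. -/
def pdim (L : List (Finset A)) : ℕ := (L.map fun B => B.card - 1).sum

/-- The facet relation on ordered partitions. -/
def PFacet (x y : List (Finset A)) : Prop :=
  Refines x y ∧ x ≠ y ∧ pdim y = pdim x + 1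

/-- A cycle of a discrete vector field on a poset of ordered partitions. -/
def PCycle (V : Set (List (Finset A) × List (Finset A))) (k : ℕ)
    (a : Fin (k + 1) → List (Finset A)) (b : Fin k → List (Finset A)) : Prop :=
  0 < k ∧ a 0 = a (Fin.last k) ∧
    ∀ i : Fin k, (a i.castSucc, b i) ∈ V ∧ (a i.succ, b i) ∉ V ∧ PFacet (a i.succ) (b i)

/-- A discrete vector field on ordered partitions is a gradient field if it has no cycle. -/
def PGradient (V : Set (List (Finset A) × List (Finset A))) : Prop :=
  ∀ k a b, ¬ PCycle V k a b

/-- Critical cells of a discrete vector field `V` on the set of cells `S`. -/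
def CritOn (S : Set (List (Finset A)))
    (V : Set (List (Finset A) × List (Finset A))) : Set (List (Finset A)) :=
  {x | x ∈ S ∧ ∀ p ∈ V, p.1 ≠ x ∧ p.2 ≠ x}

end Core
/-- The maximal element of a finite nonempty linearly ordered set. -/
def mA (A : Type*) [LinearOrder A] [Fintype A] [Nonempty A] : A :=
  Finset.univ.max' Finset.univ_nonempty

section VrA

variable {A : Type*} [LinearOrder A] [Fintype A]

/-- `P^m_A`: ordered partitions of `A` of the form `λ|m`. -/
def PmA (m : A) : Set (List (Finset A)) :=
  {L | ∃ L', IsOPart (Finset.univ.erase m) L' ∧ L = L' ++ [({m} : Finset A)]}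

/-- `P^r_A = P_A ∖ P^m_A`. -/
def PrA (m : A) : Set (List (Finset A)) :=
  {L | IsOPart Finset.univ L} \ PmA m

/-- The discrete vector field `V^r_A` on `P^r_A`. -/
def VrA (m : A) : Set (List (Finset A) × List (Finset A)) :=
  {p | ∃ (C B D : Finset A) (π ρ : List (Finset A)),
    B.Nonempty ∧ Disjoint C B ∧ Disjoint C D ∧ Disjoint B D ∧
    C ∪ B ∪ D = Finset.univ.erase m ∧ IsOPart C π ∧ IsOPart D ρ ∧
    p = (π ++ [({m} : Finset A)] ++ [B] ++ ρ, π ++ [insert m B] ++ ρ)}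

/-- The function `h_A(λ) = (#C, #B)` where `λ = π|B|ρ` is the unique presentation
with `m ∈ B`, `π` a partition of `C` and `ρ` a partition of `D`. -/
def hAf (m : A) (L : List (Finset A)) : ℤ × ℤ :=
  (((L.takeWhile fun B => decide (m ∉ B)).foldr (· ∪ ·) (∅ : Finset A)).card,
    match L.dropWhile fun B => decide (m ∉ B) with
    | [] => 0
    | B :: _ => B.card)

end VrA

/-- The order `≤̇` on `ℤ × ℤ₊`: `(s,t) ≤̇ (s',t')` iff `s > s'`, or `s = s'` and
`1 ≠ t ≤ t'`, or `s = s'` and `t' = 1`. -/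
def dotLE (x y : ℤ × ℤ) : Prop :=
  y.1 < x.1 ∨ (x.1 = y.1 ∧ x.2 ≠ 1 ∧ x.2 ≤ y.2) ∨ (x.1 = y.1 ∧ y.2 = 1)

/-- The strict version of `≤̇`. -/
def dotLT (x y : ℤ × ℤ) : Prop := dotLE x y ∧ x ≠ y

section Auxiliary

variable {A : Type*} [DecidableEq A]

@[simp] lemma blocksUnion_nil : blocksUnion ([] : List (Finset A)) = ∅ := rfl

@[simp] lemma blocksUnion_cons (B : Finset A) (L : List (Finset A)) :
    blocksUnion (B :: L) = B ∪ blocksUnion L := rfl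

lemma mem_blocksUnion {a : A} {L : List (Finset A)} :
    a ∈ blocksUnion L ↔ ∃ B ∈ L, a ∈ B := by
  induction L with
  | nil => simp
  | cons B L ih => simp [ih]

@[simp] lemma blocksUnion_append (L M : List (Finset A)) :
    blocksUnion (L ++ M) = blocksUnion L ∪ blocksUnion M := by
  induction L with
  | nil => simp
  | cons B L ih => simp [ih, Finset.union_assoc]

lemma disjoint_blocksUnion {B : Finset A} {L : List (Finset A)} :
    Disjoint B (blocksUnion L) ↔ ∀ C ∈ L, Disjoint B C := by
  induction L with
  | nil => simp
  | cons C L ih => simp [ih, Finset.disjoint_union_right]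

lemma isOPart_cons {S B : Finset A} {L : List (Finset A)} :
    IsOPart S (B :: L) ↔
      B.Nonempty ∧ Disjoint B (blocksUnion L) ∧ IsOPart (blocksUnion L) L ∧
        B ∪ blocksUnion L = S := by
  simp only [IsOPart, List.mem_cons, forall_eq_or_imp, List.pairwise_cons,
    disjoint_blocksUnion, blocksUnion_cons, and_true]
  tauto

lemma isOPart_append {S : Finset A} {L M : List (Finset A)} :
    IsOPart S (L ++ M) ↔
      IsOPart (blocksUnion L) L ∧ IsOPart (blocksUnion M) M ∧
        Disjoint (blocksUnion L) (blocksUnion M) ∧ blocksUnion L ∪ blocksUnion M = S := by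
  have h : Disjoint (blocksUnion L) (blocksUnion M) ↔ ∀ B ∈ L, ∀ C ∈ M, Disjoint B C := by
    rw [disjoint_comm, disjoint_blocksUnion]
    exact forall₂_congr fun B _ => by rw [disjoint_comm, disjoint_blocksUnion]
  simp only [IsOPart, List.mem_append, or_imp, forall_and, List.pairwise_append, h,
    blocksUnion_append, and_true]
  tauto

lemma IsOPart.pdim_add_length {S : Finset A} {L : List (Finset A)} (h : IsOPart S L) :
    pdim L + L.length = S.card := by
  induction L generalizing S with
  | nil => simp [← h.2.2, pdim]
  | cons B L ih =>
    obtain ⟨hB, hd, hL, rfl⟩ := isOPart_cons.1 h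
    have := ih hL
    have := hB.card_pos
    rw [Finset.card_union_of_disjoint hd]
    simp only [pdim, List.map_cons, List.sum_cons, List.length_cons] at *
    omega

lemma exists_map_singleton_of_length_flatten {α : Type*} {LL : List (List α)}
    (hne : ∀ l ∈ LL, l ≠ []) (h : LL.flatten.length ≤ LL.length) :
    ∃ L : List α, LL = L.map fun a => [a] := by
  induction LL with
  | nil => exact ⟨[], rfl⟩
  | cons l LL ih =>
    have hge : ∀ M : List (List α), (∀ l ∈ M, l ≠ []) → M.length ≤ M.flatten.length := by
      intro M hM
      induction M with
      | nil => simp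
      | cons l M ih =>
        have := ih fun l hl => hM l (by simp [hl])
        have := List.length_pos_iff.2 (hM l (by simp))
        simp only [List.flatten_cons, List.length_append, List.length_cons]
        omega
    have h1 := hge LL fun l hl => hne l (by simp [hl])
    have h2 := List.length_pos_iff.2 (hne l (by simp))
    simp only [List.flatten_cons, List.length_append, List.length_cons] at h
    obtain ⟨a, rfl⟩ := List.length_eq_one_iff.1 (show l.length = 1 by omega)
    obtain ⟨L, rfl⟩ := ih (fun l hl => hne l (by simp [hl])) (by omega)
    exact ⟨a :: L, rfl⟩

lemma exists_pair_of_length_flatten {α : Type*} {LL : List (List α)}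
    (hne : ∀ l ∈ LL, l ≠ []) (h : LL.flatten.length = LL.length + 1) :
    ∃ (L : List α) (p q : α) (M : List α),
      LL = (L.map fun a => [a]) ++ [p, q] :: M.map fun a => [a] := by
  induction LL with
  | nil => simp at h
  | cons l LL ih =>
    have hne' : ∀ l ∈ LL, l ≠ [] := fun l hl => hne l (by simp [hl])
    simp only [List.flatten_cons, List.length_append, List.length_cons] at h
    match l, hne l (by simp) with
    | [a], _ =>
      obtain ⟨L, p, q, M, rfl⟩ := ih hne' (by simp only [List.length_singleton] at h; omega)
      exact ⟨a :: L, p, q, M, rfl⟩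
    | p :: q :: r, _ =>
      simp only [List.length_cons] at h
      obtain ⟨M, rfl⟩ := exists_map_singleton_of_length_flatten hne' (by omega)
      have hr : r = [] := by
        refine List.length_eq_zero_iff.1 ?_
        simp only [← List.flatMap_def, List.flatMap_singleton', List.length_map] at h
        omega
      subst hr
      exact ⟨[], p, q, M, rfl⟩

/-- A facet of an ordered partition is obtained by splitting one block in two. -/
lemma PFacet.exists_split {S : Finset A} {x y : List (Finset A)} (hx : IsOPart S x)
    (hy : IsOPart S y) (h : PFacet x y) :
    ∃ (L : List (Finset A)) (P Q : Finset A) (R : List (Finset A)),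
      x = L ++ P :: Q :: R ∧ y = L ++ (P ∪ Q) :: R := by
  obtain ⟨⟨LL, hne, rfl, rfl⟩, -, hd⟩ := h
  have h1 := hx.pdim_add_length
  have h2 := hy.pdim_add_length
  rw [List.length_map] at h2
  obtain ⟨L, P, Q, R, rfl⟩ := exists_pair_of_length_flatten hne (by omega)
  refine ⟨L, P, Q, R, ?_, ?_⟩
  · simp [← List.flatMap_def]
  · simp [Function.comp_def]

lemma exists_first_block {m : A} {L : List (Finset A)} (h : ∃ B ∈ L, m ∈ B) :
    ∃ (π : List (Finset A)) (B : Finset A) (ρ : List (Finset A)),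
      L = π ++ B :: ρ ∧ m ∈ B ∧ m ∉ blocksUnion π := by
  induction L with
  | nil => simp at h
  | cons C L ih =>
    by_cases hC : m ∈ C
    · exact ⟨[], C, L, rfl, hC, by simp⟩
    · obtain ⟨π, B, ρ, rfl, hB, hπ⟩ := ih (by simpa [hC] using h)
      exact ⟨C :: π, B, ρ, rfl, hB, by simp [hC, hπ]⟩

end Auxiliary

section Morse

variable {A : Type*} [LinearOrder A]

lemma hAf_append_cons {m : A} {π ρ : List (Finset A)} {B : Finset A}
    (hπ : m ∉ blocksUnion π) (hB : m ∈ B) :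
    hAf m (π ++ B :: ρ) = (((blocksUnion π).card : ℤ), (B.card : ℤ)) := by
  have h : ∀ C ∈ π, decide (m ∉ C) = true := by
    intro C hC
    simpa using fun hm => hπ (mem_blocksUnion.2 ⟨C, hC, hm⟩)
  unfold hAf
  rw [List.takeWhile_append_of_pos h, List.dropWhile_append_of_pos h,
    List.takeWhile_cons_of_neg (by simpa using hB), List.dropWhile_cons_of_neg (by simpa using hB)]
  simp [blocksUnion]

lemma dotLE_refl (x : ℤ × ℤ) : dotLE x x := by
  unfold dotLE
  by_cases h : x.2 = 1 <;> simp [h]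

lemma dotLE_trans {x y z : ℤ × ℤ} (h₁ : dotLE x y) (h₂ : dotLE y z) : dotLE x z := by
  unfold dotLE at *
  omega

lemma dotLE_antisymm {x y : ℤ × ℤ} (h₁ : dotLE x y) (h₂ : dotLE y x) : x = y := by
  unfold dotLE at *
  ext <;> omega

lemma dotLE_trans_dotLT {x y z : ℤ × ℤ} (h₁ : dotLE x y) (h₂ : dotLT y z) : dotLT x z :=
  ⟨dotLE_trans h₁ h₂.1, fun h => h₂.2 (dotLE_antisymm h₂.1 (h ▸ h₁))⟩

variable [Fintype A]

lemma isOPart_of_mem_VrA {m : A} {x y : List (Finset A)} (h : (x, y) ∈ VrA m) :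
    IsOPart Finset.univ x ∧ IsOPart Finset.univ y := by
  obtain ⟨C, B, D, π, ρ, hB, hCB, hCD, hBD, hU, hπ, hρ, hp⟩ := h
  obtain ⟨rfl, rfl⟩ := Prod.mk.inj hp
  obtain rfl := hπ.2.2
  obtain rfl := hρ.2.2
  have hm : m ∉ blocksUnion π ∪ B ∪ blocksUnion ρ := by simp [hU]
  have hun : insert m (blocksUnion π ∪ B ∪ blocksUnion ρ) = Finset.univ := by simp [hU]
  simp only [Finset.mem_union, not_or] at hm
  rw [← hun]
  simp only [List.append_assoc, List.cons_append, List.nil_append, isOPart_append, isOPart_cons,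
    blocksUnion_cons, Finset.disjoint_union_right, Finset.disjoint_insert_left,
    Finset.disjoint_insert_right, Finset.disjoint_singleton_left, Finset.disjoint_singleton_right]
  refine ⟨?_, ?_⟩
  · simp only [hπ, hρ, hm, hB, hCB, hCD, hBD, true_and, not_false_eq_true, and_true,
      Finset.singleton_nonempty]
    grind
  · simp only [hπ, hρ, hm, hCB, hCD, hBD, true_and, not_false_eq_true, and_true,
      Finset.insert_nonempty]
    grind

lemma dotLT_hAf_of_mem_VrA {m : A} {x y : List (Finset A)} (h : (x, y) ∈ VrA m) :
    dotLT (hAf m y) (hAf m x) := by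
  obtain ⟨C, B, D, π, ρ, hB, -, -, -, hU, hπ, -, hp⟩ := h
  obtain ⟨rfl, rfl⟩ := Prod.mk.inj hp
  obtain rfl := hπ.2.2
  have hm : m ∉ blocksUnion π ∪ B ∪ D := by simp [hU]
  simp only [Finset.mem_union, not_or] at hm
  simp only [List.append_assoc, List.cons_append, List.nil_append]
  rw [hAf_append_cons hm.1.1 (by simp), hAf_append_cons hm.1.1 (by simp)]
  have := hB.card_pos
  rw [Finset.card_insert_of_notMem hm.1.2]
  refine ⟨Or.inr (Or.inr (by simp)), fun h => ?_⟩
  simp only [Prod.mk.injEq, Finset.card_singleton] at h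
  omega

lemma dotLE_hAf_of_notMem_VrA {m : A} {x y : List (Finset A)} (hx : IsOPart Finset.univ x)
    (hy : IsOPart Finset.univ y) (hxy : PFacet x y) (hV : (x, y) ∉ VrA m) :
    dotLE (hAf m x) (hAf m y) := by
  obtain ⟨L, P, Q, R, rfl, rfl⟩ := hxy.exists_split hx hy
  by_cases hL : m ∈ blocksUnion L
  · obtain ⟨π, B, ρ, rfl, hB, hπ⟩ := exists_first_block (mem_blocksUnion.1 hL)
    simp only [List.append_assoc, List.cons_append]
    rw [hAf_append_cons hπ hB, hAf_append_cons hπ hB]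
    exact dotLE_refl _
  obtain ⟨hLp, hPQR, hdL, hU⟩ := isOPart_append.1 hx
  obtain ⟨hP, hdP, hQR, -⟩ := isOPart_cons.1 hPQR
  obtain ⟨hQ, hdQ, hR, -⟩ := isOPart_cons.1 hQR
  simp only [blocksUnion_cons, Finset.disjoint_union_right] at hdL hdP hU
  by_cases hmP : m ∈ P
  · rw [hAf_append_cons hL hmP, hAf_append_cons hL (by simp [hmP])]
    refine Or.inr (Or.inl ⟨rfl, fun h1 => hV ?_, ?_⟩)
    · obtain ⟨a, rfl⟩ := Finset.card_eq_one.1 (Nat.cast_eq_one.1 h1)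
      obtain rfl := Finset.mem_singleton.1 hmP
      simp only [Finset.disjoint_singleton_left, Finset.disjoint_singleton_right] at hdP hdL
      refine ⟨blocksUnion L, Q, blocksUnion R, L, R, hQ, hdL.2.1, hdL.2.2, hdQ, ?_, hLp, hR, ?_⟩
      · rw [← hU]
        grind
      · simp
    · exact Nat.cast_le.2 (Finset.card_le_card Finset.subset_union_left)
  by_cases hmQ : m ∈ Q
  · have e := hAf_append_cons (m := m) (π := L ++ [P]) (ρ := R) (by simp [hL, hmP]) hmQ
    simp only [List.append_assoc, List.cons_append, List.nil_append, blocksUnion_append,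
      blocksUnion_cons, blocksUnion_nil, Finset.union_empty] at e
    rw [e, hAf_append_cons hL (by simp [hmQ]), Finset.card_union_of_disjoint hdL.1]
    have := hP.card_pos
    exact Or.inl (by push_cast; omega)
  have hmR : m ∈ blocksUnion R := by
    have := Finset.mem_univ m
    rw [← hU] at this
    simpa [hL, hmP, hmQ] using this
  obtain ⟨π, B, ρ, rfl, hB, hπ⟩ := exists_first_block (mem_blocksUnion.1 hmR)
  have e₁ := hAf_append_cons (m := m) (π := L ++ P :: Q :: π) (ρ := ρ)
    (by simp [hL, hmP, hmQ, hπ]) hB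
  have e₂ := hAf_append_cons (m := m) (π := L ++ (P ∪ Q) :: π) (ρ := ρ)
    (by simp [hL, hmP, hmQ, hπ]) hB
  simp only [List.append_assoc, List.cons_append, blocksUnion_append, blocksUnion_cons,
    Finset.union_assoc] at e₁ e₂
  rw [e₁, e₂]
  exact dotLE_refl _

lemma pGradient_VrA (m : A) : PGradient (VrA m) := by
  rintro k a b ⟨hk, h0, hc⟩
  have ha : ∀ i, IsOPart Finset.univ (a i) := by
    intro i
    induction i using Fin.lastCases with
    | last =>
      rw [← h0]
      exact (isOPart_of_mem_VrA (hc ⟨0, hk⟩).1).1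
    | cast i => exact (isOPart_of_mem_VrA (hc i).1).1
  have hstep : ∀ i : Fin k, dotLT (hAf m (a i.succ)) (hAf m (a i.castSucc)) := fun i =>
    dotLE_trans_dotLT
      (dotLE_hAf_of_notMem_VrA (ha _) (isOPart_of_mem_VrA (hc i).1).2 (hc i).2.2 (hc i).2.1)
      (dotLT_hAf_of_mem_VrA (hc i).1)
  have hle : ∀ i, dotLE (hAf m (a i)) (hAf m (a 0)) := by
    intro i
    induction i using Fin.induction with
    | zero => exact dotLE_refl _
    | succ i ih => exact dotLE_trans (hstep i).1 ih
  obtain ⟨n, rfl⟩ : ∃ n, k = n + 1 := ⟨k - 1, by omega⟩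
  have hlast := hstep (Fin.last n)
  rw [Fin.succ_last, ← h0] at hlast
  exact hlast.2 (dotLE_antisymm hlast.1 (hle _))

end Morse

/-- The function `h_A : P^r_A → (ℤ×ℤ₊, ≤̇)`, `h_A(π|B|ρ) = (#C, #B)`
for the unique presentation with `m ∈ B`, is a discrete Morse function associated to
`V^r_A`; consequently `V^r_A` is a gradient field on `P^r_A`. -/
theorem stmt_7 {A : Type*} [LinearOrder A] [Fintype A] [Nonempty A] :
    (∀ x y : List (Finset A), x ∈ PrA (mA A) → y ∈ PrA (mA A) → PFacet x y →
      ((x, y) ∈ VrA (mA A) → dotLT (hAf (mA A) y) (hAf (mA A) x)) ∧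
        ((x, y) ∉ VrA (mA A) → dotLE (hAf (mA A) x) (hAf (mA A) y))) ∧
      PGradient (VrA (mA A)) := by
  refine ⟨fun x y hx hy hxy => ⟨dotLT_hAf_of_mem_VrA, ?_⟩, pGradient_VrA _⟩
  exact dotLE_hAf_of_notMem_VrA hx.1 hy.1 hxy
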